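/- arXiv:2308.06815 — 2 statements merged into one kernel-verified Lean document; each statement's English description precedes it below -/
import Mathlib

section
/- Let E be a real inner product space and let n₀, nᵢ ∈ E be unit vectors with α := ⟪nᵢ, n₀⟫ satisfying |α| < 1, and set v* := (1/√(1−α²)) • (α • n₀ − nᵢ). If v ∈ E is a unit vector with ⟪v, n₀⟫ = 0 and |⟪v, nᵢ⟫| = √(1 − α²), then v = v* or v = −v*. -/
open RealInnerProductSpace

/-- The maximizers of `|⟪v, nᵢ⟫|` among unit vectors `v` tangent to the
hyperplane with normal `n₀` are exactly `±v*` where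
`v* = (1/√(1-α²)) • (α • n₀ - nᵢ)`. -/
theorem optimal_direction_unique
    {E : Type*} [NormedAddCommGroup E] [InnerProductSpace ℝ E]
    (n₀ nᵢ : E) (hn₀ : ‖n₀‖ = 1) (hnᵢ : ‖nᵢ‖ = 1)
    (α : ℝ) (hα : α = ⟪nᵢ, n₀⟫) (hlt : |α| < 1)
    (vstar : E)
    (hvstar : vstar = (1 / Real.sqrt (1 - α ^ 2)) • (α • n₀ - nᵢ))
    (v : E) (hv : ‖v‖ = 1) (hvn₀ : ⟪v, n₀⟫ = 0)
    (hmax : |⟪v, nᵢ⟫| = Real.sqrt (1 - α ^ 2)) :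
    v = vstar ∨ v = -vstar := by
  have hsq : 0 < 1 - α ^ 2 := by linarith [(sq_lt_one_iff_abs_lt_one α).2 hlt]
  have hs : 0 < Real.sqrt (1 - α ^ 2) := Real.sqrt_pos.2 hsq
  have hw : ‖α • n₀ - nᵢ‖ = Real.sqrt (1 - α ^ 2) := by
    have hinner : ⟪n₀, nᵢ⟫ = α := by rw [hα, real_inner_comm]
    rw [← Real.sqrt_sq (norm_nonneg (α • n₀ - nᵢ)), norm_sub_sq_real, norm_smul,
      real_inner_smul_left, hinner, hn₀, hnᵢ, Real.norm_eq_abs, mul_one, sq_abs]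
    congr 1
    ring
  have hnorm : ‖vstar‖ = 1 := by
    rw [hvstar, norm_smul, hw, Real.norm_of_nonneg (by positivity),
      one_div_mul_cancel hs.ne']
  have hinner : ⟪v, vstar⟫ = -(⟪v, nᵢ⟫ / Real.sqrt (1 - α ^ 2)) := by
    rw [hvstar, real_inner_smul_right, inner_sub_right, real_inner_smul_right, hvn₀]
    ring
  rcases (abs_eq hs.le).1 hmax with h | h
  · right
    rw [← inner_eq_one_iff_of_norm_eq_one (𝕜 := ℝ) hv (by rwa [norm_neg]),
      inner_neg_right, hinner, h, div_self hs.ne', neg_neg]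
  · left
    rw [← inner_eq_one_iff_of_norm_eq_one (𝕜 := ℝ) hv hnorm, hinner, h, neg_div,
      div_self hs.ne', neg_neg]
end

section
/- Let E be a real inner product space and let n₀, nᵢ ∈ E be unit vectors with α := ⟪nᵢ, n₀⟫ satisfying |α| < 1, and let x₀ ∈ E. Then the minimum of ‖(x₀ + t(v) • v) − x₀‖ over unit vectors v with ⟪v, n₀⟫ = 0 and ⟪v, nᵢ⟫ ≠ 0, where t(v) := −⟪x₀, nᵢ⟫ / ⟪v, nᵢ⟫, equals |⟪x₀, nᵢ⟫| / √(1 − α²); i.e., the least distance from x₀ to the hyperplane {x : ⟪x, nᵢ⟫ = 0} along directions tangent to the hyperplane with normal n₀ is |⟪x₀, nᵢ⟫| / √(1 − α²). -/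
open RealInnerProductSpace

/-- The norm of the component of a unit vector orthogonal to another unit vector. -/
theorem norm_sub_inner_smul_of_norm_eq_one
    {E : Type*} [NormedAddCommGroup E] [InnerProductSpace ℝ E]
    {n m : E} (hn : ‖n‖ = 1) (hm : ‖m‖ = 1) :
    ‖m - ⟪m, n⟫ • n‖ = Real.sqrt (1 - ⟪m, n⟫ ^ 2) := by
  rw [← Real.sqrt_sq (norm_nonneg (m - ⟪m, n⟫ • n)), norm_sub_sq_real, inner_smul_right,
    norm_smul, hn, hm, mul_one, Real.norm_eq_abs, sq_abs]
  ring_nf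

/-- The least distance from `x₀` to the hyperplane `{x : ⟪x, nᵢ⟫ = 0}` along
unit directions tangent to the hyperplane with normal `n₀` equals
`|⟪x₀, nᵢ⟫| / √(1 - α²)`. -/
theorem min_ray_distance
    {E : Type*} [NormedAddCommGroup E] [InnerProductSpace ℝ E]
    (n₀ nᵢ : E) (hn₀ : ‖n₀‖ = 1) (hnᵢ : ‖nᵢ‖ = 1)
    (α : ℝ) (hα : α = ⟪nᵢ, n₀⟫) (hlt : |α| < 1) (x₀ : E) :
    IsLeast
      {d : ℝ | ∃ v : E, ‖v‖ = 1 ∧ ⟪v, n₀⟫ = 0 ∧ ⟪v, nᵢ⟫ ≠ 0 ∧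
        d = ‖(x₀ + ((-⟪x₀, nᵢ⟫) / ⟪v, nᵢ⟫) • v) - x₀‖}
      (|⟪x₀, nᵢ⟫| / Real.sqrt (1 - α ^ 2)) := by
  have hpos : 0 < 1 - α ^ 2 := by
    have := (sq_lt_one_iff_abs_lt_one α).2 hlt
    linarith
  have hs : 0 < Real.sqrt (1 - α ^ 2) := Real.sqrt_pos.2 hpos
  have hss : Real.sqrt (1 - α ^ 2) ^ 2 = 1 - α ^ 2 := Real.sq_sqrt hpos.le
  have hw : ‖nᵢ - α • n₀‖ = Real.sqrt (1 - α ^ 2) := by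
    rw [hα]
    exact norm_sub_inner_smul_of_norm_eq_one hn₀ hnᵢ
  have hdist (v : E) (hv : ‖v‖ = 1) :
      ‖(x₀ + ((-⟪x₀, nᵢ⟫) / ⟪v, nᵢ⟫) • v) - x₀‖ = |⟪x₀, nᵢ⟫| / |⟪v, nᵢ⟫| := by
    rw [add_sub_cancel_left, norm_smul, hv, mul_one, Real.norm_eq_abs, abs_div, abs_neg]
  constructor
  · have hv : ‖(Real.sqrt (1 - α ^ 2))⁻¹ • (nᵢ - α • n₀)‖ = 1 := by
      rw [norm_smul, hw, Real.norm_eq_abs, abs_of_pos (inv_pos.2 hs), inv_mul_cancel₀ hs.ne']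
    have hvi : ⟪(Real.sqrt (1 - α ^ 2))⁻¹ • (nᵢ - α • n₀), nᵢ⟫ = Real.sqrt (1 - α ^ 2) := by
      rw [real_inner_smul_left, inner_sub_left, real_inner_smul_left,
        real_inner_self_eq_norm_sq, hnᵢ, real_inner_comm, ← hα, one_pow, ← pow_two,
        inv_mul_eq_iff_eq_mul₀ hs.ne', ← pow_two, hss]
    refine ⟨_, hv, ?_, ?_, ?_⟩
    · rw [real_inner_smul_left, inner_sub_left, real_inner_smul_left,
        real_inner_self_eq_norm_sq, hn₀, ← hα]
      ring
    · rw [hvi]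
      exact hs.ne'
    · rw [hdist _ hv, hvi, abs_of_pos hs]
  · rintro d ⟨v, hv, hv₀, hvi, rfl⟩
    rw [hdist v hv]
    have hle : |⟪v, nᵢ⟫| ≤ Real.sqrt (1 - α ^ 2) := by
      have h := abs_real_inner_le_norm v (nᵢ - α • n₀)
      rwa [inner_sub_right, inner_smul_right, hv₀, mul_zero, sub_zero, hv, one_mul, hw] at h
    exact div_le_div_of_nonneg_left (abs_nonneg _) (abs_pos.2 hvi) hle
end
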